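/- Fix β = 1.02 and K = √(2πe). For every real t ≥ 1 and every q ∈ ℝ with Φ(q) = 1 − 1/(K·t), one has q < β·√(log(e·t²) − log log(e·t²)). -/

import Mathlib

open Real MeasureTheory

/-- The cumulative distribution function of the standard Gaussian distribution. -/
noncomputable def Phi (x : ℝ) : ℝ :=
  (Real.sqrt (2 * Real.pi))⁻¹ * ∫ u in Set.Iic x, Real.exp (-u ^ 2 / 2)

/-- The derivative of a rational upper approximation to the Gaussian tail integral. -/
theorem hasDerivAt_gaussian_tail_approx {u : ℝ} (hu : 0 < u) :
    HasDerivAt (fun u : ℝ => Real.exp (-u ^ 2 / 2) * ((u ^ 2 + 2) / (u * (u ^ 2 + 3))))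
      (-(Real.exp (-u ^ 2 / 2) * (1 + 6 / (u * (u ^ 2 + 3)) ^ 2))) u := by
  have hden : u * (u ^ 2 + 3) ≠ 0 := by positivity
  have hexp : HasDerivAt (fun u : ℝ => Real.exp (-u ^ 2 / 2))
      (Real.exp (-u ^ 2 / 2) * (-u)) u := by
    have h := ((hasDerivAt_pow 2 u).fun_neg.div_const 2).exp
    convert h using 1
    push_cast
    ring
  have hnum : HasDerivAt (fun u : ℝ => u ^ 2 + 2) (2 * u) u := by
    simpa using (hasDerivAt_pow 2 u).add_const (2 : ℝ)
  have hd : HasDerivAt (fun u : ℝ => u * (u ^ 2 + 3)) (3 * u ^ 2 + 3) u := by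
    refine ((hasDerivAt_id' u).fun_mul ((hasDerivAt_pow 2 u).add_const (3 : ℝ))).congr_deriv ?_
    push_cast
    ring
  refine (hexp.fun_mul (hnum.fun_div hd hden)).congr_deriv ?_
  field_simp
  ring

theorem integrable_exp_neg_sq_div_two : Integrable (fun u : ℝ => Real.exp (-u ^ 2 / 2)) := by
  refine (integrable_exp_neg_mul_sq (b := 1 / 2) (by norm_num)).congr (ae_of_all _ fun u => ?_)
  simp only
  congr 1
  ring

theorem integral_exp_neg_sq_div_two :
    ∫ u : ℝ, Real.exp (-u ^ 2 / 2) = Real.sqrt (2 * Real.pi) := by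
  have h := integral_gaussian (1 / 2)
  rw [show Real.pi / (1 / 2) = 2 * Real.pi by ring] at h
  rw [← h]
  congr 1 with u
  congr 1
  ring

/-- A Mills-ratio bound for the Gaussian tail. -/
theorem integral_Ioi_exp_neg_sq_div_two_le {x : ℝ} (hx : 0 < x) :
    ∫ u in Set.Ioi x, Real.exp (-u ^ 2 / 2) ≤
      Real.exp (-x ^ 2 / 2) * ((x ^ 2 + 2) / (x * (x ^ 2 + 3))) := by
  have hderiv : ∀ u ∈ Set.Ici x, HasDerivAt
      (fun u : ℝ => Real.exp (-u ^ 2 / 2) * ((u ^ 2 + 2) / (u * (u ^ 2 + 3))))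
      (-(Real.exp (-u ^ 2 / 2) * (1 + 6 / (u * (u ^ 2 + 3)) ^ 2))) u :=
    fun u hu => hasDerivAt_gaussian_tail_approx (hx.trans_le hu)
  have hneg : ∀ u ∈ Set.Ioi x,
      -(Real.exp (-u ^ 2 / 2) * (1 + 6 / (u * (u ^ 2 + 3)) ^ 2)) ≤ 0 := fun u _ =>
    neg_nonpos.2 (by positivity)
  have hlim : Filter.Tendsto
      (fun u : ℝ => Real.exp (-u ^ 2 / 2) * ((u ^ 2 + 2) / (u * (u ^ 2 + 3))))
      Filter.atTop (nhds 0) := by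
    refine tendsto_of_tendsto_of_tendsto_of_le_of_le' tendsto_const_nhds
      tendsto_inv_atTop_zero ?_ ?_
    · filter_upwards [Filter.eventually_gt_atTop 0] with u hu
      positivity
    · filter_upwards [Filter.eventually_gt_atTop 0] with u hu
      have h1 : Real.exp (-u ^ 2 / 2) ≤ 1 := Real.exp_le_one_iff.2 (by nlinarith [sq_nonneg u])
      have h2 : (u ^ 2 + 2) / (u * (u ^ 2 + 3)) ≤ u⁻¹ := by
        rw [inv_eq_one_div, div_le_div_iff₀ (by positivity) hu]
        nlinarith
      calc _ ≤ 1 * u⁻¹ := by gcongr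
        _ = u⁻¹ := one_mul _
  have hint := integrableOn_Ioi_deriv_of_nonpos' hderiv hneg hlim
  have heq := integral_Ioi_of_hasDerivAt_of_nonpos' hderiv hneg hlim
  rw [integral_neg] at heq
  have hle : ∫ u in Set.Ioi x, Real.exp (-u ^ 2 / 2) ≤
      ∫ u in Set.Ioi x, Real.exp (-u ^ 2 / 2) * (1 + 6 / (u * (u ^ 2 + 3)) ^ 2) := by
    refine setIntegral_mono_on integrable_exp_neg_sq_div_two.integrableOn
      (by simpa using hint.neg) measurableSet_Ioi fun u _ => ?_
    exact le_mul_of_one_le_right (Real.exp_pos _).le (le_add_of_nonneg_right (by positivity))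
  linarith

theorem Phi_eq_one_sub (x : ℝ) :
    Phi x = 1 - (Real.sqrt (2 * Real.pi))⁻¹ * ∫ u in Set.Ioi x, Real.exp (-u ^ 2 / 2) := by
  have h := intervalIntegral.integral_Iic_add_Ioi (b := x)
    integrable_exp_neg_sq_div_two.integrableOn integrable_exp_neg_sq_div_two.integrableOn
  rw [integral_exp_neg_sq_div_two] at h
  have hpos : (0 : ℝ) < Real.sqrt (2 * Real.pi) := by positivity
  rw [Phi, eq_sub_iff_add_eq, ← mul_add, h, inv_mul_cancel₀ hpos.ne']

theorem log_sub_log_lower {L : ℝ} (hL : 1 ≤ L) :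
    Real.log L - 0.45 ≤ Real.log (1.0404 * (L - Real.log L)) := by
  have hL0 : 0 < L := by linarith
  have hlog : Real.log L ≤ L * Real.exp (-1) := by
    have h := Real.add_one_le_exp (Real.log L - 1)
    rw [sub_eq_add_neg, Real.exp_add, Real.exp_log hL0] at h
    linarith
  have he : Real.exp (-1) ≤ 0.368 := by
    have := Real.exp_neg_one_lt_d9
    linarith
  have hexp : Real.exp (-0.45) ≤ 0.65 := by
    have h := Real.quadratic_le_exp_of_nonneg (x := 0.45) (by norm_num)
    rw [Real.exp_neg]
    exact inv_le_of_inv_le₀ (by norm_num) (by linarith)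
  rw [Real.le_log_iff_exp_le (by nlinarith), sub_eq_add_neg, Real.exp_add, Real.exp_log hL0]
  nlinarith

theorem gaussian_tail_approx_lt {L : ℝ} (hL : 1 ≤ L) :
    Real.exp (-(1.02 * Real.sqrt (L - Real.log L)) ^ 2 / 2) *
      (((1.02 * Real.sqrt (L - Real.log L)) ^ 2 + 2) / (1.02 * Real.sqrt (L - Real.log L) *
        ((1.02 * Real.sqrt (L - Real.log L)) ^ 2 + 3))) < Real.exp (-L / 2) := by
  have hw : 1 ≤ L - Real.log L := by
    linarith [Real.log_le_sub_one_of_pos (show 0 < L by linarith)]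
  have hlow := log_sub_log_lower hL
  set w := L - Real.log L with hwdef
  set x := 1.02 * Real.sqrt w with hxdef
  have hx : 0 < x := by positivity
  have hx2 : x ^ 2 = 1.0404 * w := by
    rw [hxdef, mul_pow, Real.sq_sqrt (by linarith)]
    norm_num
  have hlogx : Real.log x = Real.log (1.0404 * w) / 2 := by
    rw [← hx2, Real.log_pow]
    push_cast
    ring
  have hlog : 2 / (2 * x ^ 2 + 5) ≤ Real.log (x ^ 2 + 3) - Real.log (x ^ 2 + 2) := by
    rw [← Real.log_div (by positivity) (by positivity)]
    have h := Real.le_log_one_add_of_nonneg (x := 1 / (x ^ 2 + 2)) (by positivity)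
    convert h using 1
    · field_simp
      ring
    · congr 1
      field_simp
      ring
  have hrat : 0.45 < 0.0404 * w + 4 / (2.0808 * w + 5) := by
    rw [← sub_lt_iff_lt_add', lt_div_iff₀ (by linarith)]
    nlinarith [sq_nonneg (w - 4.4)]
  rw [← Real.log_lt_log_iff (by positivity) (by positivity),
    Real.log_mul (by positivity) (by positivity), Real.log_div (by positivity) (by positivity),
    Real.log_mul (by positivity) (by positivity), Real.log_exp, Real.log_exp, hlogx]
  rw [hx2] at hlog ⊢
  have hhalf : 4 / (2.0808 * w + 5) = 2 * (2 / (2 * (1.0404 * w) + 5)) := by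
    rw [show 2 * (1.0404 * w) + 5 = 2.0808 * w + 5 by ring]
    ring
  linarith

theorem ucl_quantile_bound (t q : ℝ) (ht : 1 ≤ t)
    (hq : Phi q = 1 - 1 / (Real.sqrt (2 * Real.pi * Real.exp 1) * t)) :
    q < 1.02 * Real.sqrt (Real.log (Real.exp 1 * t ^ 2) -
      Real.log (Real.log (Real.exp 1 * t ^ 2))) := by
  have ht0 : 0 < t := by linarith
  have hlogL : Real.log (Real.exp 1 * t ^ 2) = 1 + 2 * Real.log t := by
    rw [Real.log_mul (by positivity) (by positivity), Real.log_exp, Real.log_pow]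
    push_cast
    ring
  have hL : 1 ≤ Real.log (Real.exp 1 * t ^ 2) := by
    linarith [Real.log_nonneg ht]
  have hexp : Real.exp (-Real.log (Real.exp 1 * t ^ 2) / 2) =
      (Real.sqrt (Real.exp 1) * t)⁻¹ := by
    rw [hlogL, show -(1 + 2 * Real.log t) / 2 = -(1 / 2 + Real.log t) by ring, Real.exp_neg,
      Real.exp_add, Real.exp_log ht0, Real.exp_half]
  have htail : ∫ u in Set.Ioi q, Real.exp (-u ^ 2 / 2) =
      Real.exp (-Real.log (Real.exp 1 * t ^ 2) / 2) := by
    have hpos : (0 : ℝ) < Real.sqrt (2 * Real.pi) := by positivity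
    rw [Phi_eq_one_sub, sub_right_inj, Real.sqrt_mul (by positivity) (Real.exp 1), mul_assoc, one_div,
      mul_inv, ← hexp] at hq
    exact mul_left_cancel₀ (inv_ne_zero hpos.ne') hq
  have hbound := gaussian_tail_approx_lt hL
  generalize Real.log (Real.exp 1 * t ^ 2) = L at *
  by_contra! hle
  have hw : 0 < L - Real.log L := by
    linarith [Real.log_le_sub_one_of_pos (show 0 < L by linarith)]
  have hmono : ∫ u in Set.Ioi q, Real.exp (-u ^ 2 / 2) ≤
      ∫ u in Set.Ioi (1.02 * Real.sqrt (L - Real.log L)), Real.exp (-u ^ 2 / 2) :=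
    setIntegral_mono_set integrable_exp_neg_sq_div_two.integrableOn
      (ae_of_all _ fun u => (Real.exp_pos _).le) (Set.Ioi_subset_Ioi hle).eventuallyLE
  have hmills := integral_Ioi_exp_neg_sq_div_two_le
    (x := 1.02 * Real.sqrt (L - Real.log L)) (by positivity)
  linarith
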